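/- For every τ ∈ [0,1] and every even integer N ≥ 2, the moment generating function M_τ satisfies the seventh-order linear differential equation Σ_{k=0}^{7} A_k(t)·M_τ^{(k)}(t) = 0 for all t ∈ ℝ. -/

import Mathlib

open Real MeasureTheory Finset

/-- The rescaled (monic-type) Hermite polynomials `C_k` with parameter `τ`:
`C_0(x) = 1`, `C_1(x) = x`, `C_{k+1}(x) = x·C_k(x) − k·τ·C_{k−1}(x)`. -/
noncomputable def CH (τ : ℝ) : ℕ → ℝ → ℝ
  | 0 => fun _ => 1
  | 1 => fun x => x
  | (k+2) => fun x => x * CH τ (k+1) x - ((k : ℝ) + 1) * τ * CH τ k x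

/-- The elliptic GinUE part `R_N^{(1)}` of the real-eigenvalue density. -/
noncomputable def R1 (τ : ℝ) (N : ℕ) (x : ℝ) : ℝ :=
  (Real.exp (-x^2/(1+τ)) / Real.sqrt (2*Real.pi)) *
    ∑ k ∈ Finset.range (N-1), (CH τ k x)^2 / (Nat.factorial k : ℝ)

/-- The correction part `R_N^{(2)}` of the real-eigenvalue density. -/
noncomputable def R2 (τ : ℝ) (N : ℕ) (x : ℝ) : ℝ :=
  (1/((1+τ) * (Nat.factorial (N-2) : ℝ))) * (Real.exp (-x^2/(2*(1+τ))) / Real.sqrt (2*Real.pi)) *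
    CH τ (N-1) x * (∫ u in (0:ℝ)..x, Real.exp (-u^2/(2*(1+τ))) * CH τ (N-2) u)

/-- The density `R_N` of real eigenvalues of the elliptic GinOE. -/
noncomputable def Rd (τ : ℝ) (N : ℕ) (x : ℝ) : ℝ := R1 τ N x + R2 τ N x

/-- The moment generating function of real eigenvalues of the elliptic GinOE. -/
noncomputable def MGF (τ : ℝ) (N : ℕ) (t : ℝ) : ℝ := ∫ x : ℝ, Real.exp (t*x) * Rd τ N x

/-- The `p`-th spectral moment of real eigenvalues of the elliptic GinOE. -/
noncomputable def Mom (τ : ℝ) (N : ℕ) (p : ℕ) : ℝ := ∫ x : ℝ, x^p * Rd τ N x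

/-- The elliptic GinUE part `u` of the moment generating function. -/
noncomputable def uF (τ : ℝ) (N : ℕ) (t : ℝ) : ℝ := ∫ x : ℝ, Real.exp (t*x) * R1 τ N x

/-- The part `v` of the moment generating function coming from `R_N^{(2)}`. -/
noncomputable def vF (τ : ℝ) (N : ℕ) (t : ℝ) : ℝ := ∫ x : ℝ, Real.exp (t*x) * R2 τ N x

open Polynomial in
/-- The polynomial `a(t)`. -/
noncomputable def pa (τ Nr : ℝ) : Polynomial ℝ :=
  C (-2*τ^2*(1+τ)^3*(1+2*τ)) * X^6
  + C (4*τ*(1+τ)^2*(1+8*τ-5*τ*(1-τ^2)*Nr)) * X^4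
  + C (8*(1-τ^2)*(1-3*τ-30*τ^2+(1-τ^2)*(3+4*τ+4*τ^2)*Nr+2*(1-τ^2)^2*Nr^2)) * X^2
  + C (32*(1-τ)^2*(1+6*τ+2*(1-τ^2)*Nr))

open Polynomial in
/-- The polynomial `b(t)`. -/
noncomputable def pb (τ Nr : ℝ) : Polynomial ℝ :=
  C (-2*τ*(1+τ)^2*(1-τ-6*τ^2)) * X^5
  + C (4*(1-τ^2)*((1-2*τ)*(1+7*τ)+2*(1-τ)^3*(1+τ)*Nr)) * X^3
  - C (32*(1-τ)^2*(1+6*τ+2*(1-τ^2)*Nr)) * X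

open Polynomial in
/-- The polynomial `c(t)`. -/
noncomputable def pc (τ Nr : ℝ) : Polynomial ℝ :=
  C (4*τ*(1-τ^2)*(1+2*τ)) * X^4 - C (8*(1-τ)^2*(1+6*τ+2*Nr*(1-τ^2))) * X^2

open Polynomial in
/-- The polynomial `d(t)`. -/
noncomputable def pd (τ Nr : ℝ) : Polynomial ℝ :=
  C (τ*(1+τ)*(2+τ)*(1+2*τ)) * X^5 - C (2*(1-τ)*(4+17*τ+6*τ^2+2*Nr*(1-τ^2))) * X^3

open Polynomial in
/-- The polynomial `q(t) = 2τ(1+τ)(4−τ)t² − 4(1−τ)`. -/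
noncomputable def pq (τ : ℝ) : Polynomial ℝ :=
  C (2*τ*(1+τ)*(4-τ)) * X^2 - C (4*(1-τ))

open Polynomial in
/-- `t·β_{k,j}(t)`, the numerators (after multiplying by `t`) of the rational functions
`β_{k,j}` from the paper; each is a genuine polynomial. -/
noncomputable def tβ (τ Nr : ℝ) : ℕ → ℕ → Polynomial ℝ
  | 4, 0 => C (4*(1-τ)) * pc τ Nr * X
  | 3, 0 => C (4*(1-τ)) * (pb τ Nr + C 2 * derivative (pc τ Nr)) * X + pq τ * pc τ Nr
  | 3, 1 => -(C (8*(1-τ)) * pc τ Nr * X)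
  | 2, 0 => C (4*(1-τ)) * (pa τ Nr + C 2 * derivative (pb τ Nr)
              + derivative (derivative (pc τ Nr))) * X
            + pq τ * (pb τ Nr + derivative (pc τ Nr)) + C (3*τ^2*(1+τ)^2) * X^3 * pc τ Nr
  | 2, 1 => -(C (8*(1-τ)) * (pb τ Nr + derivative (pc τ Nr)) * X) - pq τ * pc τ Nr
  | 2, 2 => -(C (4*(1-τ)) * pc τ Nr * X)
  | 2, 3 => C (8*(1-τ)) * pc τ Nr * X
  | 1, 0 => C (4*(1-τ)) * (C 2 * derivative (pa τ Nr)
              + derivative (derivative (pb τ Nr))) * X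
            + pq τ * (pa τ Nr + derivative (pb τ Nr)) + C (3*τ^2*(1+τ)^2) * X^3 * pb τ Nr
  | 1, 1 => -(C (8*(1-τ)) * (pa τ Nr + derivative (pb τ Nr)) * X) - pq τ * pb τ Nr
  | 1, 2 => -(C (4*(1-τ)) * pb τ Nr * X)
  | 1, 3 => C (8*(1-τ)) * pb τ Nr * X
  | 0, 0 => C (4*(1-τ)) * derivative (derivative (pa τ Nr)) * X + pq τ * derivative (pa τ Nr)
            + C (3*τ^2*(1+τ)^2) * X^3 * pa τ Nr - C (4*Nr*τ^2*(1+τ)^5) * X^2 * pd τ Nr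
  | 0, 1 => -(C (8*(1-τ)) * derivative (pa τ Nr) * X) - pq τ * pa τ Nr
  | 0, 2 => -(C (4*(1-τ)) * pa τ Nr * X)
  | 0, 3 => C (8*(1-τ)) * pa τ Nr * X
  | _, _ => 0

open Polynomial in
/-- The polynomial `B_k(t) = t⁻⁴(β_{k,0}d² + β_{k,1}dd′ + β_{k,2}dd″ + β_{k,3}d′²)`,
realised as exact division by `t⁵` of the numerator `t·(…)`. -/
noncomputable def Bpoly (τ Nr : ℝ) (k : ℕ) : Polynomial ℝ :=
  (tβ τ Nr k 0 * (pd τ Nr)^2 + tβ τ Nr k 1 * pd τ Nr * derivative (pd τ Nr)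
    + tβ τ Nr k 2 * pd τ Nr * derivative (derivative (pd τ Nr))
    + tβ τ Nr k 3 * (derivative (pd τ Nr))^2) /ₘ X^5

open Polynomial in
/-- The polynomial coefficients `α_{k,j}(t)`. -/
noncomputable def alph (τ Nr : ℝ) : ℕ → ℕ → Polynomial ℝ
  | 7, 4 => C ((1-τ)/2)
  | 6, 4 => C (-((1+τ)*(τ^2-3*τ+1)/2)) * X
  | 6, 3 => C ((1-τ)/2)
  | 5, 4 => -(C ((1+τ)/2) * (C (2*τ*(1-τ^2)) * X^2 + C ((1-τ^2)*Nr + 5 - 15*τ + 6*τ^2)))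
  | 5, 3 => C (-((1+τ)*(τ^2-3*τ+1)/2)) * X
  | 5, 2 => C ((1-τ)/2)
  | 4, 4 => -(C (τ*(1+τ)^2/2) * (C (τ*(1+τ)) * X^2 + C ((1+τ)*Nr + 18 - 19*τ)) * X)
  | 4, 3 => -(C ((1+τ)/2) * (C (2*τ*(1-τ^2)) * X^2 + C ((1-τ^2)*Nr + 4 - 12*τ + 5*τ^2)))
  | 4, 2 => C (-((1+τ)*(τ^2-3*τ+1)/2)) * X
  | 4, 1 => C ((1-τ)/2)
  | 3, 4 => -(C (2*τ*(1+τ)^2) * (C (3*τ*(1+τ)) * X^2 + C ((1+τ)*Nr + 8 - 9*τ)))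
  | 3, 3 => -(C (τ*(1+τ)^2/2) * (C (τ*(1+τ)) * X^2 + C ((1+τ)*Nr + 14 - 15*τ)) * X)
  | 3, 2 => -(C ((1+τ)/2) * (C (2*τ*(1-τ^2)) * X^2 + C ((1-τ^2)*Nr + 3 - 9*τ + 4*τ^2)))
  | 3, 1 => C (-((1+τ)*(τ^2-3*τ+1)/2)) * X
  | 3, 0 => C ((1-τ)/2)
  | 2, 4 => C (-18*τ^2*(1+τ)^3) * X
  | 2, 3 => -(C (3*τ*(1+τ)^2/2) * (C (3*τ*(1+τ)) * X^2 + C ((1+τ)*Nr + 6 - 7*τ)))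
  | 2, 2 => -(C (τ*(1+τ)^2/2) * (C (τ*(1+τ)) * X^2 + C ((1+τ)*Nr + 10 - 11*τ)) * X)
  | 2, 1 => -(C ((1+τ)/2) * (C (2*τ*(1-τ^2)) * X^2 + C ((1-τ^2)*Nr + 2 - 6*τ + 3*τ^2)))
  | 2, 0 => C (-((1+τ)*(τ^2-3*τ+1)/2)) * X
  | 1, 4 => C (-12*τ^2*(1+τ)^3)
  | 1, 3 => C (-9*τ^2*(1+τ)^3) * X
  | 1, 2 => -(C (τ*(1+τ)^2) * (C (3*τ*(1+τ)) * X^2 + C ((1+τ)*Nr + 4 - 5*τ)))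
  | 1, 1 => -(C (τ*(1+τ)^2/2) * (C (τ*(1+τ)) * X^2 + C ((1+τ)*Nr + 6 - 7*τ)) * X)
  | 1, 0 => -(C ((1-τ^2)/2) * (C (2*τ*(1+τ)) * X^2 + C ((1+τ)*Nr + 1 - 2*τ)))
  | 0, 3 => C (-3*τ^2*(1+τ)^3)
  | 0, 2 => C (-3*τ^2*(1+τ)^3) * X
  | 0, 1 => -(C (τ*(1+τ)^2/2) * (C (3*τ*(1+τ)) * X^2 + C ((1+τ)*Nr + 2 - 3*τ)))
  | 0, 0 => -(C (τ*(1+τ)^2/2) * (C (τ*(1+τ)) * X^2 + C ((1+τ)*Nr + 2 - 3*τ)) * X)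
  | _, _ => 0

/-- The polynomial `A_k(t) = Σ_{j=0}^{4} α_{k,j}(t)·B_j(t)`. -/
noncomputable def Apoly (τ Nr : ℝ) (k : ℕ) : Polynomial ℝ :=
  ∑ j ∈ Finset.range 5, alph τ Nr k j * Bpoly τ Nr j

theorem integrable_exp_neg_one_mul_abs : Integrable fun x : ℝ => exp (-1 * |x|) := by
  refine (integrable_inv_one_add_sq.const_mul 2).mono'
    (by fun_prop : Continuous fun x : ℝ => exp (-1 * |x|)).aestronglyMeasurable
    (.of_forall fun x => ?_)
  have hquad := quadratic_le_exp_of_nonneg (abs_nonneg x)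
  rw [norm_eq_abs, abs_of_pos (exp_pos _), neg_one_mul, exp_neg, ← div_eq_mul_inv,
    inv_eq_one_div, div_le_div_iff₀ (exp_pos _) (by positivity)]
  nlinarith [sq_abs x, abs_nonneg x]

/-- A continuous function decaying faster than every exponential `exp (-c * |x|)`. -/
structure SuperExpDecay (f : ℝ → ℝ) : Prop where
  continuous : Continuous f
  bound : ∀ c : ℝ, ∃ K : ℝ, ∀ x, |f x| ≤ K * exp (-c * |x|)

namespace SuperExpDecay

variable {f g : ℝ → ℝ}

theorem add (hf : SuperExpDecay f) (hg : SuperExpDecay g) :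
    SuperExpDecay (fun x => f x + g x) := by
  refine ⟨hf.continuous.add hg.continuous, fun c => ?_⟩
  obtain ⟨K, hK⟩ := hf.bound c
  obtain ⟨L, hL⟩ := hg.bound c
  refine ⟨K + L, fun x => (abs_add_le _ _).trans ?_⟩
  rw [add_mul]
  exact add_le_add (hK x) (hL x)

theorem const_mul (hf : SuperExpDecay f) (a : ℝ) : SuperExpDecay (fun x => a * f x) := by
  refine ⟨hf.continuous.const_mul a, fun c => ?_⟩
  obtain ⟨K, hK⟩ := hf.bound c
  refine ⟨|a| * K, fun x => ?_⟩
  rw [abs_mul, mul_assoc]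
  exact mul_le_mul_of_nonneg_left (hK x) (abs_nonneg a)

theorem mul_of_abs_le (hf : SuperExpDecay f) (hg : Continuous g) {K : ℝ}
    (hK : ∀ x, |g x| ≤ K * |x|) : SuperExpDecay (fun x => g x * f x) := by
  refine ⟨hg.mul hf.continuous, fun c => ?_⟩
  obtain ⟨L, hL⟩ := hf.bound (c + 1)
  refine ⟨K * L, fun x => ?_⟩
  have hgx : 0 ≤ K * |x| := (abs_nonneg _).trans (hK x)
  have hK0 : 0 ≤ K := by simpa using (abs_nonneg _).trans (hK 1)
  have hL0 : 0 ≤ L := by simpa using (abs_nonneg _).trans (hL 0)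
  have hx : |x| ≤ exp |x| := by linarith [add_one_le_exp |x|]
  calc |g x * f x| = |g x| * |f x| := abs_mul _ _
    _ ≤ (K * |x|) * (L * exp (-(c + 1) * |x|)) :=
        mul_le_mul (hK x) (hL x) (abs_nonneg _) hgx
    _ = K * L * (|x| * exp (-(c + 1) * |x|)) := by ring
    _ ≤ K * L * (exp |x| * exp (-(c + 1) * |x|)) := by gcongr
    _ = K * L * exp (-c * |x|) := by rw [← exp_add]; ring_nf

theorem id_mul (hf : SuperExpDecay f) : SuperExpDecay (fun x => x * f x) :=
  hf.mul_of_abs_le continuous_id (K := 1) fun x => by simp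

theorem pow_mul (hf : SuperExpDecay f) (k : ℕ) : SuperExpDecay (fun x => x ^ k * f x) := by
  induction k with
  | zero => simpa using hf
  | succ k ih => simpa only [pow_succ', mul_assoc] using ih.id_mul

theorem sum {ι : Type*} {s : Finset ι} {F : ι → ℝ → ℝ} (hF : ∀ i ∈ s, SuperExpDecay (F i)) :
    SuperExpDecay (fun x => ∑ i ∈ s, F i x) := by
  classical
  induction s using Finset.induction_on with
  | empty => exact ⟨by simpa using continuous_const, fun c => ⟨0, by simp⟩⟩
  | insert i s hi ih =>
    simp only [Finset.sum_insert hi]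
    exact (hF i (by simp)).add (ih fun j hj => hF j (by simp [hj]))

theorem gaussian {s : ℝ} (hs : 0 < s) : SuperExpDecay (fun x => exp (-x ^ 2 / s)) := by
  refine ⟨by fun_prop, fun c => ⟨exp (c ^ 2 * s / 4), fun x => ?_⟩⟩
  rw [abs_of_pos (exp_pos _), ← exp_add, exp_le_exp, div_le_iff₀ hs]
  nlinarith [sq_nonneg (|x| - c * s / 2), sq_abs x]

theorem integrable (hf : SuperExpDecay f) : Integrable f := by
  obtain ⟨K, hK⟩ := hf.bound 1
  have hint : Integrable fun x : ℝ => K * exp (-1 * |x|) :=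
    integrable_exp_neg_one_mul_abs.const_mul K
  exact hint.mono' hf.continuous.aestronglyMeasurable (.of_forall hK)

theorem exp_mul (hf : SuperExpDecay f) (t : ℝ) : SuperExpDecay (fun x => exp (t * x) * f x) := by
  refine ⟨by have := hf.continuous; fun_prop, fun c => ?_⟩
  obtain ⟨K, hK⟩ := hf.bound (c + |t|)
  refine ⟨K, fun x => ?_⟩
  calc |exp (t * x) * f x| = exp (t * x) * |f x| := by rw [abs_mul, abs_of_pos (exp_pos _)]
    _ ≤ exp (|t| * |x|) * (K * exp (-(c + |t|) * |x|)) :=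
        mul_le_mul (exp_le_exp.2 ((le_abs_self _).trans (abs_mul t x).le)) (hK x)
          (abs_nonneg _) (exp_pos _).le
    _ = K * exp (-c * |x|) := by rw [mul_left_comm, ← exp_add]; ring_nf

end SuperExpDecay

/-- The two-sided Laplace transform `t ↦ ∫ exp (t * x) * f x`. -/
noncomputable def bilateralLaplace (f : ℝ → ℝ) (t : ℝ) : ℝ := ∫ x : ℝ, exp (t * x) * f x

section bilateralLaplace

variable {f g : ℝ → ℝ}

theorem bilateralLaplace_add (hf : SuperExpDecay f) (hg : SuperExpDecay g) (t : ℝ) :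
    bilateralLaplace (fun x => f x + g x) t = bilateralLaplace f t + bilateralLaplace g t := by
  simp only [bilateralLaplace, mul_add]
  exact integral_add (hf.exp_mul t).integrable (hg.exp_mul t).integrable

theorem bilateralLaplace_const_mul (a : ℝ) (f : ℝ → ℝ) (t : ℝ) :
    bilateralLaplace (fun x => a * f x) t = a * bilateralLaplace f t := by
  simp only [bilateralLaplace, mul_left_comm _ a, integral_const_mul]

theorem bilateralLaplace_of_hasDerivAt (hf : SuperExpDecay f) (hg : SuperExpDecay g)
    (hfg : ∀ x, HasDerivAt f (g x) x) (t : ℝ) :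
    bilateralLaplace g t = -t * bilateralLaplace f t := by
  have hderiv : ∀ x, HasDerivAt (fun x => exp (t * x) * f x)
      (t * (exp (t * x) * f x) + exp (t * x) * g x) x := fun x =>
    ((((hasDerivAt_id x).const_mul t).exp).mul (hfg x)).congr_deriv (by simp; ring)
  have hint := (hf.exp_mul t).integrable.const_mul t
  have hzero := integral_eq_zero_of_hasDerivAt_of_integrable hderiv
    (hint.add (hg.exp_mul t).integrable) (hf.exp_mul t).integrable
  rw [integral_add hint (hg.exp_mul t).integrable, integral_const_mul] at hzero
  simp only [bilateralLaplace]
  linarith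

theorem hasDerivAt_bilateralLaplace (hf : SuperExpDecay f) (t : ℝ) :
    HasDerivAt (bilateralLaplace f) (bilateralLaplace (fun x => x * f x) t) t := by
  obtain ⟨K, hK⟩ := hf.id_mul.bound (|t| + 2)
  refine (hasDerivAt_integral_of_dominated_loc_of_deriv_le
    (F := fun s x => exp (s * x) * f x) (F' := fun s x => exp (s * x) * (x * f x))
    (bound := fun x => K * exp (-1 * |x|)) (Metric.ball_mem_nhds t one_pos) ?_
    (hf.exp_mul t).integrable (hf.id_mul.exp_mul t).continuous.aestronglyMeasurable ?_ ?_ ?_).2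
  · exact .of_forall fun s => (hf.exp_mul s).continuous.aestronglyMeasurable
  · refine .of_forall fun x s hs => ?_
    have hst : |s| ≤ |t| + 1 := by
      have := abs_sub_abs_le_abs_sub s t
      rw [Metric.mem_ball, dist_eq] at hs
      linarith
    calc ‖exp (s * x) * (x * f x)‖ = exp (s * x) * |x * f x| := by
          rw [norm_eq_abs, abs_mul, abs_of_pos (exp_pos _)]
      _ ≤ exp ((|t| + 1) * |x|) * (K * exp (-(|t| + 2) * |x|)) := by
          refine mul_le_mul (exp_le_exp.2 ?_) (hK x) (abs_nonneg _) (exp_pos _).le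
          calc s * x ≤ |s| * |x| := (le_abs_self _).trans (abs_mul s x).le
            _ ≤ (|t| + 1) * |x| := by gcongr
      _ = K * exp (-1 * |x|) := by rw [mul_left_comm, ← exp_add]; ring_nf
  · exact integrable_exp_neg_one_mul_abs.const_mul K
  · refine .of_forall fun x s _ => ?_
    exact ((((hasDerivAt_id s).mul_const x).exp).mul_const (f x)).congr_deriv (by simp; ring)

theorem hasDerivAt_bilateralLaplace_pow_mul (hf : SuperExpDecay f) (k : ℕ) (t : ℝ) :
    HasDerivAt (bilateralLaplace fun x => x ^ k * f x)
      (bilateralLaplace (fun x => x ^ (k + 1) * f x) t) t := by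
  simpa only [pow_succ', mul_assoc] using hasDerivAt_bilateralLaplace (hf.pow_mul k) t

theorem iteratedDeriv_bilateralLaplace (hf : SuperExpDecay f) (k : ℕ) :
    iteratedDeriv k (bilateralLaplace f) = bilateralLaplace fun x => x ^ k * f x := by
  induction k with
  | zero => simp
  | succ k ih =>
    rw [iteratedDeriv_succ, ih]
    exact funext fun t => (hasDerivAt_bilateralLaplace_pow_mul hf k t).deriv

end bilateralLaplace

section Hermite

variable {τ : ℝ}

theorem mul_nat_mul_CH_pred (τ : ℝ) (k : ℕ) (x : ℝ) :
    τ * (k * CH τ (k - 1) x) = x * CH τ k x - CH τ (k + 1) x := by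
  cases k with
  | zero => simp [CH]
  | succ k =>
    simp only [CH, Nat.add_sub_cancel]
    push_cast
    ring

theorem hasDerivAt_CH (τ : ℝ) (k : ℕ) (x : ℝ) :
    HasDerivAt (CH τ k) (k * CH τ (k - 1) x) x := by
  induction k using Nat.twoStepInduction with
  | zero => simpa [CH] using hasDerivAt_const x (1 : ℝ)
  | one => simpa [CH] using hasDerivAt_id' x
  | more k ihk ihk1 =>
    have hd := ((hasDerivAt_id x).mul ihk1).sub (ihk.const_mul (((k : ℝ) + 1) * τ))
    refine hd.congr_deriv ?_
    simp only [id_eq, Nat.add_sub_cancel, Nat.cast_add, Nat.cast_one,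
      show k + 2 - 1 = k + 1 from rfl]
    push_cast
    linear_combination (-((k : ℝ) + 1)) * mul_nat_mul_CH_pred τ k x

theorem SuperExpDecay.CH_mul {f : ℝ → ℝ} (hf : SuperExpDecay f) (τ : ℝ) (k : ℕ) :
    SuperExpDecay (fun x => CH τ k x * f x) := by
  induction k using Nat.twoStepInduction with
  | zero => simpa [CH] using hf
  | one => simpa [CH] using hf.id_mul
  | more k ihk ihk1 =>
    convert ihk1.id_mul.add (ihk.const_mul (-(((k : ℝ) + 1) * τ))) using 2 with x
    simp only [CH]
    ring

/-- The product of two rescaled Hermite polynomials with the Gaussian weight. -/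
noncomputable def hermiteProd (τ : ℝ) (a b : ℕ) (x : ℝ) : ℝ :=
  CH τ a x * (CH τ b x * exp (-x ^ 2 / (1 + τ)))

/-- A rescaled Hermite polynomial with half of the Gaussian weight, times the primitive of the
`m`-th such function. -/
noncomputable def hermitePrimitive (τ : ℝ) (m a : ℕ) (x : ℝ) : ℝ :=
  CH τ a x * ((∫ s in (0 : ℝ)..x, exp (-s ^ 2 / (2 * (1 + τ))) * CH τ m s)
    * exp (-x ^ 2 / (2 * (1 + τ))))

theorem hermiteProd_comm (τ : ℝ) (a b : ℕ) : hermiteProd τ a b = hermiteProd τ b a :=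
  funext fun x => by simp only [hermiteProd]; ring

theorem superExpDecay_hermiteProd (hτ : 0 < 1 + τ) (a b : ℕ) :
    SuperExpDecay (hermiteProd τ a b) :=
  ((SuperExpDecay.gaussian hτ).CH_mul τ b).CH_mul τ a

theorem superExpDecay_hermitePrimitive (hτ : 0 < 1 + τ) (m a : ℕ) :
    SuperExpDecay (hermitePrimitive τ m a) := by
  have hgauss := SuperExpDecay.gaussian (mul_pos two_pos hτ)
  have hdecay := hgauss.CH_mul τ m
  obtain ⟨K, hK⟩ := hdecay.bound 0
  refine (hgauss.mul_of_abs_le (K := K) ?_ fun x => ?_).CH_mul τ a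
  · exact intervalIntegral.continuous_primitive
      (fun a b => (hdecay.continuous.congr fun s => mul_comm _ _).intervalIntegrable a b) 0
  · have := intervalIntegral.norm_integral_le_of_norm_le_const (a := 0) (b := x) (C := K)
      (f := fun s => exp (-s ^ 2 / (2 * (1 + τ))) * CH τ m s)
      (fun s _ => by simpa [mul_comm] using hK s)
    simpa using this

theorem hasDerivAt_hermiteProd (τ : ℝ) (a b : ℕ) (x : ℝ) :
    HasDerivAt (hermiteProd τ a b)
      (a * hermiteProd τ (a - 1) b x
        + (b * hermiteProd τ a (b - 1) x + -(2 / (1 + τ)) * (x * hermiteProd τ a b x))) x := by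
  have hexp := (((hasDerivAt_pow 2 x).neg).div_const (1 + τ)).exp
  refine ((hasDerivAt_CH τ a x).mul ((hasDerivAt_CH τ b x).mul hexp)).congr_deriv ?_
  simp [hermiteProd]
  ring

theorem hasDerivAt_hermitePrimitive (hτ : 1 + τ ≠ 0) (m a : ℕ) (x : ℝ) :
    HasDerivAt (hermitePrimitive τ m a)
      (a * hermitePrimitive τ m (a - 1) x
        + (hermiteProd τ a m x + -(1 / (1 + τ)) * (x * hermitePrimitive τ m a x))) x := by
  have hexp := (((hasDerivAt_pow 2 x).neg).div_const (2 * (1 + τ))).exp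
  have hcont : Continuous fun s => exp (-s ^ 2 / (2 * (1 + τ))) * CH τ m s := by
    have : Continuous (CH τ m) :=
      continuous_iff_continuousAt.2 fun s => (hasDerivAt_CH τ m s).continuousAt
    fun_prop
  have hprim := hcont.integral_hasStrictDerivAt 0 x |>.hasDerivAt
  refine ((hasDerivAt_CH τ a x).mul (hprim.mul hexp)).congr_deriv ?_
  have hsplit : exp (-x ^ 2 / (1 + τ))
      = exp (-x ^ 2 / (2 * (1 + τ))) * exp (-x ^ 2 / (2 * (1 + τ))) := by
    rw [← exp_add]
    congr 1
    field_simp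
    ring
  simp only [hermitePrimitive, hermiteProd, hsplit, Pi.neg_apply, Pi.mul_apply]
  generalize exp (-x ^ 2 / (2 * (1 + τ))) = E
  generalize (∫ s in (0 : ℝ)..x, exp (-s ^ 2 / (2 * (1 + τ))) * CH τ m s) = F
  push_cast
  field_simp

theorem hasDerivAt_sum_hermiteProd (hτ : 1 + τ ≠ 0) (n : ℕ) (x : ℝ) :
    HasDerivAt (fun x => ∑ k ∈ Finset.range (n + 1), hermiteProd τ k k x / (Nat.factorial k : ℝ))
      (-(2 / ((1 + τ) * (Nat.factorial n : ℝ))) * hermiteProd τ (n + 1) n x) x := by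
  induction n with
  | zero =>
    simp only [zero_add, Finset.sum_range_one]
    refine ((hasDerivAt_hermiteProd τ 0 0 x).div_const _).congr_deriv ?_
    simp [hermiteProd, CH]
  | succ n ih =>
    simp only [Finset.sum_range_succ _ (n + 1)]
    refine (ih.add ((hasDerivAt_hermiteProd τ (n + 1) (n + 1) x).div_const _)).congr_deriv ?_
    have hfact : (Nat.factorial n : ℝ) ≠ 0 := by exact_mod_cast Nat.factorial_ne_zero n
    have hn : (n : ℝ) + 1 ≠ 0 := by positivity
    simp only [Nat.factorial_succ, hermiteProd, CH, Nat.add_sub_cancel]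
    push_cast
    field_simp
    ring

theorem bilateralLaplace_hermiteProd (hτ : 0 < 1 + τ) (a b : ℕ) (t : ℝ) :
    -t * bilateralLaplace (hermiteProd τ a b) t
      = a * bilateralLaplace (hermiteProd τ (a - 1) b) t
        + b * bilateralLaplace (hermiteProd τ a (b - 1)) t
        - 2 / (1 + τ) * bilateralLaplace (fun x => x * hermiteProd τ a b x) t := by
  have hdecay := superExpDecay_hermiteProd (τ := τ) hτ
  have h₁ := (hdecay (a - 1) b).const_mul a
  have h₂ := (hdecay a (b - 1)).const_mul b
  have h₃ := (hdecay a b).id_mul.const_mul (-(2 / (1 + τ)))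
  rw [← bilateralLaplace_of_hasDerivAt (hdecay a b) (h₁.add (h₂.add h₃))
    (hasDerivAt_hermiteProd τ a b), bilateralLaplace_add h₁ (h₂.add h₃),
    bilateralLaplace_add h₂ h₃]
  simp only [bilateralLaplace_const_mul]
  ring

theorem bilateralLaplace_hermitePrimitive (hτ : 0 < 1 + τ) (m a : ℕ) (t : ℝ) :
    -t * bilateralLaplace (hermitePrimitive τ m a) t
      = a * bilateralLaplace (hermitePrimitive τ m (a - 1)) t
        + bilateralLaplace (hermiteProd τ a m) t
        - 1 / (1 + τ) * bilateralLaplace (fun x => x * hermitePrimitive τ m a x) t := by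
  have hdecay := superExpDecay_hermitePrimitive (τ := τ) hτ m
  have h₁ := (hdecay (a - 1)).const_mul a
  have h₂ := superExpDecay_hermiteProd hτ a m
  have h₃ := (hdecay a).id_mul.const_mul (-(1 / (1 + τ)))
  rw [← bilateralLaplace_of_hasDerivAt (hdecay a) (h₁.add (h₂.add h₃))
    (hasDerivAt_hermitePrimitive hτ.ne' m a), bilateralLaplace_add h₁ (h₂.add h₃),
    bilateralLaplace_add h₂ h₃]
  simp only [bilateralLaplace_const_mul]
  ring

theorem mul_nat_mul_bilateralLaplace_hermiteProd (hτ : 0 < 1 + τ) (a b : ℕ) (t : ℝ) :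
    τ * (b * bilateralLaplace (hermiteProd τ a (b - 1)) t)
      = bilateralLaplace (fun x => x * hermiteProd τ a b x) t
        - bilateralLaplace (hermiteProd τ a (b + 1)) t := by
  have hdecay := superExpDecay_hermiteProd (τ := τ) hτ
  have hlaplace := bilateralLaplace_add (hdecay a (b + 1))
    (((hdecay a (b - 1)).const_mul b).const_mul τ) t
  rw [bilateralLaplace_const_mul, bilateralLaplace_const_mul] at hlaplace
  rw [eq_sub_iff_add_eq', ← hlaplace]
  congr 1
  funext x
  simp only [hermiteProd]
  linear_combination CH τ a x * exp (-x ^ 2 / (1 + τ)) * mul_nat_mul_CH_pred τ b x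

theorem mul_nat_mul_bilateralLaplace_hermitePrimitive (hτ : 0 < 1 + τ) (m a : ℕ) (t : ℝ) :
    τ * (a * bilateralLaplace (hermitePrimitive τ m (a - 1)) t)
      = bilateralLaplace (fun x => x * hermitePrimitive τ m a x) t
        - bilateralLaplace (hermitePrimitive τ m (a + 1)) t := by
  have hdecay := superExpDecay_hermitePrimitive (τ := τ) hτ m
  have hlaplace := bilateralLaplace_add (hdecay (a + 1))
    (((hdecay (a - 1)).const_mul a).const_mul τ) t
  rw [bilateralLaplace_const_mul, bilateralLaplace_const_mul] at hlaplace
  rw [eq_sub_iff_add_eq', ← hlaplace]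
  congr 1
  funext x
  simp only [hermitePrimitive]
  linear_combination (∫ s in (0 : ℝ)..x, exp (-s ^ 2 / (2 * (1 + τ))) * CH τ m s)
    * exp (-x ^ 2 / (2 * (1 + τ))) * mul_nat_mul_CH_pred τ a x

end Hermite

theorem eq_of_forall_eq_of_hasDerivAt {f g : ℝ → ℝ} {f' g' t : ℝ} (h : ∀ s, f s = g s)
    (hf : HasDerivAt f f' t) (hg : HasDerivAt g g' t) : f' = g' :=
  hf.unique (funext h ▸ hg)

theorem eq_zero_of_forall_ne_zero {f : ℝ → ℝ} (hf : Continuous f) (h : ∀ t, t ≠ 0 → f t = 0)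
    (t : ℝ) : f t = 0 :=
  congrFun (hf.ext_on (dense_compl_singleton (0 : ℝ)) continuous_zero h) t

/-- The first-order linear relations between the Laplace transforms `u`, `v` of the two parts of
the density (`u k`, `v k` being the `k`-th derivatives) and the auxiliary transforms `g₁`, `g₃`
and `h`. -/
structure LaplaceSystem (τ N : ℝ) (u v : ℕ → ℝ → ℝ) (g₁ g₃ h : ℝ → ℝ) : Prop where
  hasDerivAt_u : ∀ k t, HasDerivAt (u k) (u (k + 1) t) t
  hasDerivAt_v : ∀ k t, HasDerivAt (v k) (v (k + 1) t) t
  hasDerivAt_g₁ : ∀ t,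
    HasDerivAt g₁ ((1 + τ) / 2 * (t * g₁ t + 2 * (N - 1) * (t * u 0 t))) t
  hasDerivAt_g₃ : ∀ t, HasDerivAt g₃ ((1 + τ) / 2 * (2 * (t * u 0 t) - τ * (t * g₃ t))) t
  hasDerivAt_h : ∀ t, HasDerivAt h ((1 + τ) * (v 0 t - τ / 2 * g₃ t - τ * (t * h t))) t
  relation_u : ∀ t, (1 - τ) * (t * u 1 t + u 0 t)
    = (1 + τ) * (g₁ t - (N - 1) * τ * g₃ t - τ * (t ^ 2 * u 0 t))
  relation_v : ∀ t, v 1 t = (1 + τ) * (t * v 0 t + (N - 1) * h t + 1 / 2 * (t * u 0 t))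

namespace LaplaceSystem

variable {τ N : ℝ} {u v : ℕ → ℝ → ℝ} {g₁ g₃ h : ℝ → ℝ}

theorem relation_u_deriv (H : LaplaceSystem τ N u v g₁ g₃ h) (t : ℝ) :
    (1 - τ) * (t * u 2 t + 2 * u 1 t)
      = (1 + τ) * ((1 + τ) / 2 * (t * g₁ t) + (N - 1) * τ ^ 2 * (1 + τ) / 2 * (t * g₃ t)
        + ((N - 1) * (1 - τ ^ 2) - 2 * τ) * (t * u 0 t) - τ * (t ^ 2 * u 1 t)) := by
  have hl := (((hasDerivAt_id t).mul (H.hasDerivAt_u 1 t)).add (H.hasDerivAt_u 0 t)).const_mul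
    (1 - τ)
  have hr := (((H.hasDerivAt_g₁ t).sub ((H.hasDerivAt_g₃ t).const_mul ((N - 1) * τ))).sub
    (((hasDerivAt_pow 2 t).mul (H.hasDerivAt_u 0 t)).const_mul τ)).const_mul (1 + τ)
  have := eq_of_forall_eq_of_hasDerivAt H.relation_u hl hr
  simp only [id_eq] at this
  norm_num at this
  linear_combination this

theorem relation_u_deriv_deriv (H : LaplaceSystem τ N u v g₁ g₃ h) (t : ℝ) :
    (1 - τ) * (t * u 3 t + 3 * u 2 t)
      = (1 + τ) * ((1 + τ) / 2 * g₁ t + (N - 1) * τ ^ 2 * (1 + τ) / 2 * g₃ t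
        + (1 + τ) ^ 2 / 4 * (t ^ 2 * g₁ t) - (N - 1) * τ ^ 3 * (1 + τ) ^ 2 / 4 * (t ^ 2 * g₃ t)
        + (N - 1) * (1 + τ) ^ 2 / 2 * (1 + τ ^ 2) * (t ^ 2 * u 0 t)
        + ((N - 1) * (1 - τ ^ 2) - 2 * τ) * (u 0 t + t * u 1 t)
        - 2 * τ * (t * u 1 t) - τ * (t ^ 2 * u 2 t)) := by
  have hl := (((hasDerivAt_id t).mul (H.hasDerivAt_u 2 t)).add
    ((H.hasDerivAt_u 1 t).const_mul 2)).const_mul (1 - τ)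
  have hr := (((((hasDerivAt_id t).mul (H.hasDerivAt_g₁ t)).const_mul ((1 + τ) / 2)).add
    (((hasDerivAt_id t).mul (H.hasDerivAt_g₃ t)).const_mul ((N - 1) * τ ^ 2 * (1 + τ) / 2))).add
    (((hasDerivAt_id t).mul (H.hasDerivAt_u 0 t)).const_mul
      ((N - 1) * (1 - τ ^ 2) - 2 * τ))).sub
    (((hasDerivAt_pow 2 t).mul (H.hasDerivAt_u 1 t)).const_mul τ) |>.const_mul (1 + τ)
  have := eq_of_forall_eq_of_hasDerivAt H.relation_u_deriv hl hr
  simp only [id_eq] at this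
  norm_num at this
  linear_combination this

/-- The third-order differential equation satisfied by `u 0`. -/
theorem third_order_u (H : LaplaceSystem τ N u v g₁ g₃ h) (t : ℝ) :
    (1 - τ) * (t ^ 2 * u 3 t) + (2 * (1 - τ) * (t * u 2 t)
      + (1 + τ) * (4 * τ - 1 - τ ^ 2) / 2 * (t ^ 3 * u 2 t))
      + (-2 * (1 - τ) * u 1 t
        + ((1 + τ) * (5 * τ - 1 - τ ^ 2) - (1 - τ) * (N - 1) * (1 + τ) ^ 2) * (t ^ 2 * u 1 t)
        - 3 / 4 * (1 - τ) * τ * (1 + τ) ^ 2 * (t ^ 4 * u 1 t))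
      - (τ ^ 2 * (1 + τ) ^ 3 / 4 * (t ^ 5 * u 0 t)
        + ((N - 1) * τ * (1 + τ) ^ 3 + 5 / 4 * (1 - τ) * τ * (1 + τ) ^ 2) * (t ^ 3 * u 0 t))
      = 0 := by
  linear_combination t * H.relation_u_deriv_deriv t
    - ((1 + τ) * (1 - τ) / 2 * t ^ 2 + 1) * H.relation_u_deriv t
    - τ * (1 + τ) ^ 2 / 4 * t ^ 3 * H.relation_u t

theorem third_order_u_deriv (H : LaplaceSystem τ N u v g₁ g₃ h) (t : ℝ) :
    (1 - τ) * (t ^ 2 * u 4 t + 2 * t * u 3 t) + (2 * (1 - τ) * (t * u 3 t + u 2 t)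
      + (1 + τ) * (4 * τ - 1 - τ ^ 2) / 2 * (t ^ 3 * u 3 t + 3 * t ^ 2 * u 2 t))
      + (-2 * (1 - τ) * u 2 t
        + ((1 + τ) * (5 * τ - 1 - τ ^ 2) - (1 - τ) * (N - 1) * (1 + τ) ^ 2)
          * (t ^ 2 * u 2 t + 2 * t * u 1 t)
        - 3 / 4 * (1 - τ) * τ * (1 + τ) ^ 2 * (t ^ 4 * u 2 t + 4 * t ^ 3 * u 1 t))
      - (τ ^ 2 * (1 + τ) ^ 3 / 4 * (t ^ 5 * u 1 t + 5 * t ^ 4 * u 0 t)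
        + ((N - 1) * τ * (1 + τ) ^ 3 + 5 / 4 * (1 - τ) * τ * (1 + τ) ^ 2)
          * (t ^ 3 * u 1 t + 3 * t ^ 2 * u 0 t))
      = 0 := by
  have hp (j k : ℕ) := (hasDerivAt_pow j t).mul (H.hasDerivAt_u k t)
  have hl := ((((hp 2 3).const_mul (1 - τ)).add
    ((((hasDerivAt_id t).mul (H.hasDerivAt_u 2 t)).const_mul (2 * (1 - τ))).add
      ((hp 3 2).const_mul ((1 + τ) * (4 * τ - 1 - τ ^ 2) / 2)))).add
    ((((H.hasDerivAt_u 1 t).const_mul (-2 * (1 - τ))).add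
      ((hp 2 1).const_mul
        ((1 + τ) * (5 * τ - 1 - τ ^ 2) - (1 - τ) * (N - 1) * (1 + τ) ^ 2))).sub
      ((hp 4 1).const_mul (3 / 4 * (1 - τ) * τ * (1 + τ) ^ 2)))).sub
    (((hp 5 0).const_mul (τ ^ 2 * (1 + τ) ^ 3 / 4)).add
      ((hp 3 0).const_mul ((N - 1) * τ * (1 + τ) ^ 3 + 5 / 4 * (1 - τ) * τ * (1 + τ) ^ 2)))
  have := eq_of_forall_eq_of_hasDerivAt H.third_order_u hl (hasDerivAt_const t 0)
  simp only [id_eq] at this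
  norm_num at this
  linear_combination this

theorem second_order_v (H : LaplaceSystem τ N u v g₁ g₃ h) (t : ℝ) :
    v 2 t = (1 - τ ^ 2) * (t * v 1 t) + τ * (1 + τ) ^ 2 * (t ^ 2 * v 0 t)
      + ((N - 1) * (1 + τ) ^ 2 + (1 + τ)) * v 0 t + (1 + τ) ^ 2 * τ / 2 * (t ^ 2 * u 0 t)
      + (1 + τ) / 2 * (u 0 t + t * u 1 t) - (N - 1) * (1 + τ) ^ 2 * τ / 2 * g₃ t := by
  have hr := ((((hasDerivAt_id t).mul (H.hasDerivAt_v 0 t)).add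
    ((H.hasDerivAt_h t).const_mul (N - 1))).add
    (((hasDerivAt_id t).mul (H.hasDerivAt_u 0 t)).const_mul (1 / 2))).const_mul (1 + τ)
  have := eq_of_forall_eq_of_hasDerivAt H.relation_v (H.hasDerivAt_v 1 t) hr
  simp only [id_eq] at this
  norm_num at this
  linear_combination this + (1 + τ) * τ * t * H.relation_v t

theorem second_order_v_deriv (H : LaplaceSystem τ N u v g₁ g₃ h) (t : ℝ) :
    v 3 t = (1 - τ ^ 2) * (t * v 2 t + v 1 t) + τ * (1 + τ) ^ 2 * (t ^ 2 * v 1 t + 2 * t * v 0 t)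
      + ((N - 1) * (1 + τ) ^ 2 + (1 + τ)) * v 1 t
      + (1 + τ) ^ 2 * τ / 2 * (t ^ 2 * u 1 t + 2 * t * u 0 t)
      + (1 + τ) / 2 * (2 * u 1 t + t * u 2 t)
      - (N - 1) * (1 + τ) ^ 2 * τ / 2 * ((1 + τ) / 2 * (2 * (t * u 0 t) - τ * (t * g₃ t))) := by
  have hr := ((((((hasDerivAt_id t).mul (H.hasDerivAt_v 1 t)).const_mul (1 - τ ^ 2)).add
    (((hasDerivAt_pow 2 t).mul (H.hasDerivAt_v 0 t)).const_mul (τ * (1 + τ) ^ 2))).add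
    ((H.hasDerivAt_v 0 t).const_mul ((N - 1) * (1 + τ) ^ 2 + (1 + τ)))).add
    (((hasDerivAt_pow 2 t).mul (H.hasDerivAt_u 0 t)).const_mul ((1 + τ) ^ 2 * τ / 2))).add
    (((H.hasDerivAt_u 0 t).add ((hasDerivAt_id t).mul (H.hasDerivAt_u 1 t))).const_mul
      ((1 + τ) / 2)) |>.sub
    ((H.hasDerivAt_g₃ t).const_mul ((N - 1) * (1 + τ) ^ 2 * τ / 2))
  have := eq_of_forall_eq_of_hasDerivAt H.second_order_v (H.hasDerivAt_v 2 t) hr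
  simp only [id_eq] at this
  norm_num at this
  linear_combination this

end LaplaceSystem

/-- The `j`-th derivative of the third-order operator with coefficients `alph τ N k 0`,
applied to a function with successive derivatives `m k`. -/
noncomputable def alphSum (τ N : ℝ) (m : ℕ → ℝ → ℝ) (j : ℕ) (t : ℝ) : ℝ :=
  ∑ k ∈ Finset.range 8, (alph τ N k j).eval t * m k t

set_option maxHeartbeats 1000000 in
open Polynomial in
theorem hasDerivAt_alphSum {τ N : ℝ} {m : ℕ → ℝ → ℝ}
    (hm : ∀ k t, HasDerivAt (m k) (m (k + 1) t) t) {j : ℕ} (hj : j < 4) (t : ℝ) :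
    HasDerivAt (alphSum τ N m j) (alphSum τ N m (j + 1) t) t := by
  have hsum := HasDerivAt.fun_sum fun k (_ : k ∈ Finset.range 8) =>
    ((alph τ N k j).hasDerivAt t).mul (hm k t)
  refine hsum.congr_deriv ?_
  interval_cases j <;>
  · simp only [alphSum, alph, Finset.sum_range_succ, Finset.sum_range_zero, derivative_add,
      derivative_neg, derivative_mul, derivative_C, derivative_X, derivative_X_pow,
      derivative_zero, eval_add, eval_neg, eval_mul, eval_C, eval_X, eval_pow, eval_zero,
      eval_one]
    push_cast
    ring

open Polynomial in
/-- Applying the third-order operator to `u + v` yields a second-order expression in `u`. -/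
theorem LaplaceSystem.alphSum_zero {τ N : ℝ} {u v : ℕ → ℝ → ℝ} {g₁ g₃ h : ℝ → ℝ}
    (H : LaplaceSystem τ N u v g₁ g₃ h) (t : ℝ) :
    4 * (t ^ 2 * alphSum τ N (fun k s => u k s + v k s) 0 t) + 4 * (1 - τ) * (t * u 2 t)
      + (pq τ).eval t * u 1 t + 3 * τ ^ 2 * (1 + τ) ^ 2 * (t ^ 3 * u 0 t) = 0 := by
  simp only [alphSum, alph, pq, Finset.sum_range_succ, Finset.sum_range_zero, eval_add, eval_sub,
    eval_neg, eval_mul, eval_C, eval_X, eval_pow, eval_zero]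
  linear_combination 2 * (1 - τ) * t ^ 2 * H.second_order_v_deriv t
    + 2 * (1 + τ) * τ * t ^ 3 * H.second_order_v t
    + 2 * t * H.relation_u_deriv_deriv t
    - ((1 + τ) * (1 - 2 * τ) * t ^ 2 + 2) * H.relation_u_deriv t
    - τ * (1 + τ) ^ 2 * t ^ 3 * H.relation_u t

open Polynomial in
/-- The second-order expression in `y`, the third-order operator applied to `u + v`,
that recovers a multiple of `u`. -/
theorem LaplaceSystem.second_order_alphSum {τ N : ℝ} {u v : ℕ → ℝ → ℝ} {g₁ g₃ h : ℝ → ℝ}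
    (H : LaplaceSystem τ N u v g₁ g₃ h) {y : ℕ → ℝ → ℝ}
    (hy : y = alphSum τ N (fun k s => u k s + v k s)) (t : ℝ) :
    (pa τ N).eval t * y 0 t + (pb τ N).eval t * y 1 t + (pc τ N).eval t * y 2 t
      = -(N * (1 + τ) ^ 5 * τ ^ 2) * ((pd τ N).eval t * u 0 t) := by
  have hm (k : ℕ) (s : ℝ) : HasDerivAt (fun s => u k s + v k s) (u (k + 1) s + v (k + 1) s) s :=
    (H.hasDerivAt_u k s).add (H.hasDerivAt_v k s)
  have hyd {j : ℕ} (hj : j < 4) (s : ℝ) : HasDerivAt (y j) (y (j + 1) s) s := by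
    rw [hy]
    exact hasDerivAt_alphSum hm hj s
  have hI (s : ℝ) : 4 * (s ^ 2 * y 0 s) + 4 * (1 - τ) * (s * u 2 s)
      + (pq τ).eval s * u 1 s + 3 * τ ^ 2 * (1 + τ) ^ 2 * (s ^ 3 * u 0 s) = 0 := by
    rw [hy]
    exact H.alphSum_zero s
  have hI' (s : ℝ) : 4 * (s ^ 2 * y 1 s + 2 * (s * y 0 s))
      + 4 * (1 - τ) * (s * u 3 s + u 2 s)
      + ((pq τ).eval s * u 2 s + 4 * τ * (1 + τ) * (4 - τ) * (s * u 1 s))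
      + 3 * τ ^ 2 * (1 + τ) ^ 2 * (s ^ 3 * u 1 s + 3 * (s ^ 2 * u 0 s)) = 0 := by
    have hl := (((((hasDerivAt_pow 2 s).mul (hyd (j := 0) (by norm_num) s)).const_mul 4).add
      (((hasDerivAt_id s).mul (H.hasDerivAt_u 2 s)).const_mul (4 * (1 - τ)))).add
      (((pq τ).hasDerivAt s).mul (H.hasDerivAt_u 1 s))).add
      (((hasDerivAt_pow 3 s).mul (H.hasDerivAt_u 0 s)).const_mul (3 * τ ^ 2 * (1 + τ) ^ 2))
    have := eq_of_forall_eq_of_hasDerivAt hI hl (hasDerivAt_const s 0)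
    simp [pq] at this ⊢
    linear_combination this
  have hI'' (t : ℝ) : 4 * (t ^ 2 * y 2 t + 4 * (t * y 1 t) + 2 * y 0 t)
      + 4 * (1 - τ) * (t * u 4 t + 2 * u 3 t)
      + ((pq τ).eval t * u 3 t
        + 4 * τ * (1 + τ) * (4 - τ) * (2 * (t * u 2 t) + u 1 t))
      + 3 * τ ^ 2 * (1 + τ) ^ 2 * (t ^ 3 * u 2 t + 6 * (t ^ 2 * u 1 t) + 6 * (t * u 0 t)) = 0 := by
    have hl := ((((((hasDerivAt_pow 2 t).mul (hyd (j := 1) (by norm_num) t)).add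
      (((hasDerivAt_id t).mul (hyd (j := 0) (by norm_num) t)).const_mul 2)).const_mul 4).add
      ((((hasDerivAt_id t).mul (H.hasDerivAt_u 3 t)).add
        (H.hasDerivAt_u 2 t)).const_mul (4 * (1 - τ)))).add
      ((((pq τ).hasDerivAt t).mul (H.hasDerivAt_u 2 t)).add
        (((hasDerivAt_id t).mul (H.hasDerivAt_u 1 t)).const_mul (4 * τ * (1 + τ) * (4 - τ))))).add
      ((((hasDerivAt_pow 3 t).mul (H.hasDerivAt_u 1 t)).add
        (((hasDerivAt_pow 2 t).mul (H.hasDerivAt_u 0 t)).const_mul 3)).const_mul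
          (3 * τ ^ 2 * (1 + τ) ^ 2))
    have := eq_of_forall_eq_of_hasDerivAt hI' hl (hasDerivAt_const t 0)
    simp [pq] at this ⊢
    linear_combination this
  have hcont : Continuous fun s => (pa τ N).eval s * y 0 s + (pb τ N).eval s * y 1 s
      + (pc τ N).eval s * y 2 s + N * (1 + τ) ^ 5 * τ ^ 2 * ((pd τ N).eval s * u 0 s) := by
    have hy0 : Continuous (y 0) :=
      continuous_iff_continuousAt.2 fun s => (hyd (by norm_num) s).continuousAt
    have hy1 : Continuous (y 1) :=
      continuous_iff_continuousAt.2 fun s => (hyd (by norm_num) s).continuousAt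
    have hy2 : Continuous (y 2) :=
      continuous_iff_continuousAt.2 fun s => (hyd (by norm_num) s).continuousAt
    have hu0 : Continuous (u 0) :=
      continuous_iff_continuousAt.2 fun s => (H.hasDerivAt_u 0 s).continuousAt
    fun_prop
  have hzero := eq_zero_of_forall_ne_zero hcont (fun s hs => ?_) t
  · linear_combination hzero
  refine (mul_eq_zero.1 (?_ : s ^ 2 * _ = 0)).resolve_left (pow_ne_zero 2 hs)
  have h0 := hI s
  have h1 := hI' s
  have h2 := hI'' s
  simp only [pa, pb, pc, pd, pq, eval_add, eval_sub, eval_mul, eval_C, eval_X, eval_pow]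
    at h0 h1 h2 ⊢
  set c₀ := 4 * τ * (1 + τ) * (1 + 2 * τ) * s ^ 2 - 8 * (1 - τ) * (1 + 6 * τ
    + 2 * N * (1 - τ ^ 2)) with hc₀
  set b₀ := -2 * τ * (1 + τ) ^ 2 * (1 - τ - 6 * τ ^ 2) * s ^ 4
    + 4 * (1 - τ ^ 2) * ((1 - 2 * τ) * (1 + 7 * τ) + 2 * (1 - τ) ^ 3 * (1 + τ) * N) * s ^ 2
    - 32 * (1 - τ) ^ 2 * (1 + 6 * τ + 2 * (1 - τ ^ 2) * N) with hb₀
  linear_combination (1 - τ) * s ^ 2 * c₀ / 4 * h2 + s * (b₀ / 4 - (1 - τ) * c₀) * h1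
    + ((-2 * τ ^ 2 * (1 + τ) ^ 3 * (1 + 2 * τ) * s ^ 6
      + 4 * τ * (1 + τ) ^ 2 * (1 + 8 * τ - 5 * τ * (1 - τ ^ 2) * N) * s ^ 4
      + 8 * (1 - τ ^ 2) * (1 - 3 * τ - 30 * τ ^ 2 + (1 - τ ^ 2) * (3 + 4 * τ + 4 * τ ^ 2) * N
        + 2 * (1 - τ ^ 2) ^ 2 * N ^ 2) * s ^ 2
      + 32 * (1 - τ) ^ 2 * (1 + 6 * τ + 2 * (1 - τ ^ 2) * N)) / 4
      - b₀ / 2 + 3 * (1 - τ) * c₀ / 2) * h0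
    - (1 - τ) * s * c₀ * H.third_order_u_deriv s
    + (c₀ * (7 * (1 - τ) - τ * (1 + τ) * (4 - τ) / 2 * s ^ 2
      + (1 + τ) * (4 * τ - 1 - τ ^ 2) / 2 * s ^ 2) - b₀) * H.third_order_u s
section Elimination

open Polynomial

variable {τ N : ℝ}

theorem X_pow_five_mul_Bpoly (τ N : ℝ) {k : ℕ} (hk : k < 5) :
    X ^ 5 * Bpoly τ N k
      = tβ τ N k 0 * (pd τ N) ^ 2 + tβ τ N k 1 * pd τ N * derivative (pd τ N)
        + tβ τ N k 2 * pd τ N * derivative (derivative (pd τ N))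
        + tβ τ N k 3 * (derivative (pd τ N)) ^ 2 := by
  have hd : ∃ e, pd τ N = X ^ 3 * e :=
    ⟨C (τ*(1+τ)*(2+τ)*(1+2*τ)) * X^2 - C (2*(1-τ)*(4+17*τ+6*τ^2+2*N*(1-τ^2))), by
      simp only [pd]; ring⟩
  obtain ⟨e, he⟩ := hd
  have hβ₂ : X ∣ tβ τ N k 2 := by
    interval_cases k <;> simp only [tβ, dvd_neg, dvd_zero, dvd_mul_left]
  have hβ₃ : X ∣ tβ τ N k 3 := by
    interval_cases k <;> simp only [tβ, dvd_zero, dvd_mul_left]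
  obtain ⟨b₂, hb₂⟩ := hβ₂
  obtain ⟨b₃, hb₃⟩ := hβ₃
  have hdvd : X ^ 5 ∣ tβ τ N k 0 * (pd τ N) ^ 2 + tβ τ N k 1 * pd τ N * derivative (pd τ N)
      + tβ τ N k 2 * pd τ N * derivative (derivative (pd τ N))
      + tβ τ N k 3 * (derivative (pd τ N)) ^ 2 := by
    rw [hb₂, hb₃, he]
    simp only [derivative_mul, derivative_add, derivative_X_pow, derivative_C]
    simp only [map_natCast, Nat.add_one_sub_one]
    refine ⟨tβ τ N k 0 * (X * e ^ 2) + tβ τ N k 1 * e * (3 * e + X * derivative e)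
      + b₂ * e * (6 * e + 6 * (X * derivative e) + X ^ 2 * derivative (derivative e))
      + b₃ * (3 * e + X * derivative e) ^ 2, ?_⟩
    simp
    ring
  have hmod := (modByMonic_eq_zero_iff_dvd (monic_X_pow 5)).2 hdvd
  have hdiv := modByMonic_add_div (tβ τ N k 0 * (pd τ N) ^ 2
    + tβ τ N k 1 * pd τ N * derivative (pd τ N)
    + tβ τ N k 2 * pd τ N * derivative (derivative (pd τ N))
    + tβ τ N k 3 * (derivative (pd τ N)) ^ 2) (X ^ 5)
  rw [hmod, zero_add] at hdiv
  exact hdiv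

theorem pow_five_mul_sum_Bpoly_eq_zero {y : ℕ → ℝ → ℝ} {u : ℕ → ℝ → ℝ}
    (hy : ∀ j < 4, ∀ t, HasDerivAt (y j) (y (j + 1) t) t)
    (hu : ∀ k t, HasDerivAt (u k) (u (k + 1) t) t)
    (hfirst : ∀ t, 4 * (t ^ 2 * y 0 t) + 4 * (1 - τ) * (t * u 2 t) + (pq τ).eval t * u 1 t
      + 3 * τ ^ 2 * (1 + τ) ^ 2 * (t ^ 3 * u 0 t) = 0)
    (hsecond : ∀ t, (pa τ N).eval t * y 0 t + (pb τ N).eval t * y 1 t + (pc τ N).eval t * y 2 t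
      = -(N * (1 + τ) ^ 5 * τ ^ 2) * ((pd τ N).eval t * u 0 t)) (t : ℝ) :
    t ^ 5 * ∑ j ∈ Finset.range 5, (Bpoly τ N j).eval t * y j t = 0 := by
  have hderiv (s : ℝ) : (derivative (pa τ N)).eval s * y 0 s
      + ((pa τ N).eval s + (derivative (pb τ N)).eval s) * y 1 s
      + ((pb τ N).eval s + (derivative (pc τ N)).eval s) * y 2 s + (pc τ N).eval s * y 3 s
      = -(N * (1 + τ) ^ 5 * τ ^ 2)
        * ((derivative (pd τ N)).eval s * u 0 s + (pd τ N).eval s * u 1 s) := by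
    have h := eq_of_forall_eq_of_hasDerivAt hsecond
      (((((pa τ N).hasDerivAt s).mul (hy 0 (by norm_num) s)).add
        (((pb τ N).hasDerivAt s).mul (hy 1 (by norm_num) s))).add
        (((pc τ N).hasDerivAt s).mul (hy 2 (by norm_num) s)))
      ((((pd τ N).hasDerivAt s).mul (hu 0 s)).const_mul _)
    linear_combination h
  have hderiv₂ := eq_of_forall_eq_of_hasDerivAt hderiv
      ((((((derivative (pa τ N)).hasDerivAt t).mul (hy 0 (by norm_num) t)).add
        ((((pa τ N).hasDerivAt t).add ((derivative (pb τ N)).hasDerivAt t)).mul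
          (hy 1 (by norm_num) t))).add
        ((((pb τ N).hasDerivAt t).add ((derivative (pc τ N)).hasDerivAt t)).mul
          (hy 2 (by norm_num) t))).add
        (((pc τ N).hasDerivAt t).mul (hy 3 (by norm_num) t)))
      (((((derivative (pd τ N)).hasDerivAt t).mul (hu 0 t)).add
        (((pd τ N).hasDerivAt t).mul (hu 1 t))).const_mul _)
  have hB (j : ℕ) (hj : j < 5) := congrArg (eval t) (X_pow_five_mul_Bpoly τ N hj)
  have hB₀ := hB 0 (by norm_num)
  have hB₁ := hB 1 (by norm_num)
  have hB₂ := hB 2 (by norm_num)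
  have hB₃ := hB 3 (by norm_num)
  have hB₄ := hB 4 (by norm_num)
  simp only [tβ, eval_mul, eval_add, eval_sub, eval_neg, eval_pow, eval_X, eval_C, eval_zero]
    at hB₀ hB₁ hB₂ hB₃ hB₄
  simp only [Finset.sum_range_succ, Finset.sum_range_zero]
  have h₀ := hfirst t
  have h₁ := hsecond t
  have h₂ := hderiv t
  simp only [Pi.add_apply] at hderiv₂
  generalize eval t (pd τ N) = d at *
  generalize eval t (derivative (pd τ N)) = d' at *
  generalize eval t (derivative (derivative (pd τ N))) = d'' at *
  generalize eval t (pq τ) = q at *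
  linear_combination y 0 t * hB₀ + y 1 t * hB₁ + y 2 t * hB₂ + y 3 t * hB₃ + y 4 t * hB₄
    + 4 * (1 - τ) * t * d ^ 2 * hderiv₂ + (-8 * (1 - τ) * t * d * d' + q * d ^ 2) * h₂
    + (4 * (1 - τ) * t * (-d * d'' + 2 * d' ^ 2) - q * d * d'
      + 3 * τ ^ 2 * (1 + τ) ^ 2 * t ^ 3 * d ^ 2) * h₁
    - N * τ ^ 2 * (1 + τ) ^ 5 * d ^ 3 * h₀

theorem LaplaceSystem.sum_Apoly_eq_zero {u v : ℕ → ℝ → ℝ} {g₁ g₃ h : ℝ → ℝ}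
    (H : LaplaceSystem τ N u v g₁ g₃ h) (t : ℝ) :
    ∑ k ∈ Finset.range 8, (Apoly τ N k).eval t * (u k t + v k t) = 0 := by
  set m : ℕ → ℝ → ℝ := fun k s => u k s + v k s with hm
  have hderiv (k : ℕ) (s : ℝ) : HasDerivAt (m k) (m (k + 1) s) s :=
    (H.hasDerivAt_u k s).add (H.hasDerivAt_v k s)
  have hcont (k : ℕ) : Continuous (m k) :=
    continuous_iff_continuousAt.2 fun s => (hderiv k s).continuousAt
  have hB : ∑ j ∈ Finset.range 5, (Bpoly τ N j).eval t * alphSum τ N m j t = 0 := by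
    refine eq_zero_of_forall_ne_zero
      (f := fun s => ∑ j ∈ Finset.range 5, (Bpoly τ N j).eval s * alphSum τ N m j s)
      ?_ (fun s hs => ?_) t
    · simp only [alphSum]
      fun_prop
    · exact (mul_eq_zero.1 (pow_five_mul_sum_Bpoly_eq_zero
        (fun j hj s => hasDerivAt_alphSum hderiv hj s) H.hasDerivAt_u H.alphSum_zero
        (H.second_order_alphSum rfl) s)).resolve_left (pow_ne_zero 5 hs)
  rw [← hB]
  simp only [Apoly, alphSum, eval_finsetSum, eval_mul, Finset.sum_mul, Finset.mul_sum]
  rw [Finset.sum_comm]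
  exact Finset.sum_congr rfl fun j _ => Finset.sum_congr rfl fun k _ => by ring

end Elimination

section Density

variable {τ : ℝ}

theorem R1_eq (τ : ℝ) (m : ℕ) :
    R1 τ (m + 2) = fun x => 1 / √(2 * π)
      * ∑ k ∈ Finset.range (m + 1), hermiteProd τ k k x / (Nat.factorial k : ℝ) := by
  funext x
  simp only [R1, hermiteProd, Finset.mul_sum, show m + 2 - 1 = m + 1 from rfl]
  exact Finset.sum_congr rfl fun k _ => by ring

theorem R2_eq (τ : ℝ) (m : ℕ) :
    R2 τ (m + 2) = fun x => 2 / ((1 + τ) * (Nat.factorial m * √(2 * π))) / 2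
      * hermitePrimitive τ m (m + 1) x := by
  funext x
  simp only [R2, hermitePrimitive, Nat.add_sub_cancel, show m + 2 - 1 = m + 1 from rfl]
  simp only [div_eq_mul_inv, mul_inv]
  ring

theorem superExpDecay_R1 (hτ : 0 < 1 + τ) (m : ℕ) : SuperExpDecay (R1 τ (m + 2)) := by
  rw [R1_eq]
  refine .const_mul (.sum fun k _ => ?_) _
  simpa only [div_eq_inv_mul] using (superExpDecay_hermiteProd hτ k k).const_mul _

theorem superExpDecay_R2 (hτ : 0 < 1 + τ) (m : ℕ) : SuperExpDecay (R2 τ (m + 2)) := by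
  rw [R2_eq]
  exact (superExpDecay_hermitePrimitive hτ m (m + 1)).const_mul _

theorem mul_bilateralLaplace_R1 (hτ : 0 < 1 + τ) (m : ℕ) (t : ℝ) :
    t * bilateralLaplace (R1 τ (m + 2)) t
      = 2 / ((1 + τ) * (Nat.factorial m * √(2 * π)))
        * bilateralLaplace (hermiteProd τ (m + 1) m) t := by
  have hderiv (x : ℝ) : HasDerivAt (R1 τ (m + 2))
      (-(2 / ((1 + τ) * (Nat.factorial m * √(2 * π)))) * hermiteProd τ (m + 1) m x) x := by
    rw [R1_eq]
    refine ((hasDerivAt_sum_hermiteProd hτ.ne' m x).const_mul _).congr_deriv ?_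
    simp only [div_eq_mul_inv, mul_inv]
    ring
  have hlaplace := bilateralLaplace_of_hasDerivAt (superExpDecay_R1 hτ m)
    ((superExpDecay_hermiteProd hτ (m + 1) m).const_mul _) hderiv t
  rw [bilateralLaplace_const_mul] at hlaplace
  linear_combination hlaplace

theorem laplaceSystem_density (hτ : 0 < 1 + τ) (m : ℕ) :
    LaplaceSystem τ (m + 2)
      (fun k => bilateralLaplace fun x => x ^ k * R1 τ (m + 2) x)
      (fun k => bilateralLaplace fun x => x ^ k * R2 τ (m + 2) x)
      (fun t => 2 / ((1 + τ) * (Nat.factorial m * √(2 * π)))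
        * bilateralLaplace (hermiteProd τ (m + 1) (m + 1)) t)
      (fun t => 2 / ((1 + τ) * (Nat.factorial m * √(2 * π)))
        * bilateralLaplace (hermiteProd τ m m) t)
      (fun t => 2 / ((1 + τ) * (Nat.factorial m * √(2 * π))) / 2
        * bilateralLaplace (hermitePrimitive τ m m) t) := by
  have hR1 := superExpDecay_R1 hτ m
  have hR2 := superExpDecay_R2 hτ m
  have hprod := superExpDecay_hermiteProd hτ
  have hprim := superExpDecay_hermitePrimitive hτ m
  have hu := mul_bilateralLaplace_R1 hτ m
  have hR2_eq := R2_eq τ m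
  set c := 2 / ((1 + τ) * (Nat.factorial m * √(2 * π)))
  have hv (t : ℝ) : bilateralLaplace (R2 τ (m + 2)) t
      = c / 2 * bilateralLaplace (hermitePrimitive τ m (m + 1)) t := by
    rw [hR2_eq, bilateralLaplace_const_mul]
  have hτ0 := hτ.ne'
  refine ⟨fun k t => hasDerivAt_bilateralLaplace_pow_mul hR1 k t,
    fun k t => hasDerivAt_bilateralLaplace_pow_mul hR2 k t, fun t => ?_, fun t => ?_,
    fun t => ?_, fun t => ?_, fun t => ?_⟩ <;> simp only [pow_zero, one_mul, pow_one]
  · refine ((hasDerivAt_bilateralLaplace (hprod (m + 1) (m + 1)) t).const_mul c).congr_deriv ?_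
    have h := bilateralLaplace_hermiteProd hτ (m + 1) (m + 1) t
    rw [Nat.add_sub_cancel, hermiteProd_comm τ m (m + 1)] at h
    push_cast at h
    rw [hu]
    field_simp at h
    linear_combination c / 2 * h
  · refine ((hasDerivAt_bilateralLaplace (hprod m m) t).const_mul c).congr_deriv ?_
    have h := bilateralLaplace_hermiteProd hτ m m t
    have h' := mul_nat_mul_bilateralLaplace_hermiteProd hτ m m t
    rw [hermiteProd_comm τ (m - 1) m] at h
    rw [hermiteProd_comm τ m (m + 1)] at h'
    rw [hu]
    field_simp at h
    linear_combination -(c / 2 * τ) * h - c * (1 + τ) * h'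
  · refine ((hasDerivAt_bilateralLaplace (hprim m) t).const_mul (c / 2)).congr_deriv ?_
    have h := bilateralLaplace_hermitePrimitive hτ m m t
    have h' := mul_nat_mul_bilateralLaplace_hermitePrimitive hτ m m t
    rw [hv]
    field_simp at h
    linear_combination -(c / 2 * τ) * h - c / 2 * (1 + τ) * h'
  · have h := bilateralLaplace_hermiteProd hτ (m + 1) m t
    have h' := mul_nat_mul_bilateralLaplace_hermiteProd hτ (m + 1) m t
    rw [Nat.add_sub_cancel] at h
    push_cast at h
    have hderiv := eq_of_forall_eq_of_hasDerivAt hu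
      ((hasDerivAt_id t).mul (hasDerivAt_bilateralLaplace hR1 t))
      ((hasDerivAt_bilateralLaplace (hprod (m + 1) m) t).const_mul c)
    simp only [id_eq, one_mul] at hderiv
    field_simp at h
    linear_combination (1 - τ) * hderiv - c * τ * h - c * (1 + τ) * h'
      + (1 + τ) * τ * t * hu t
  · have h := bilateralLaplace_hermitePrimitive hτ m (m + 1) t
    rw [Nat.add_sub_cancel] at h
    push_cast at h
    have hv₁ : bilateralLaplace (fun x => x * R2 τ (m + 2) x) t
        = c / 2 * bilateralLaplace (fun x => x * hermitePrimitive τ m (m + 1) x) t := by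
      rw [hR2_eq, ← bilateralLaplace_const_mul]
      congr 1
      funext x
      ring
    rw [hv, hv₁, hu]
    field_simp at h
    linear_combination c / 2 * h

end Density

/-- **Theorem (Differential equation for the MGF of the elliptic GinOE).**
For every `τ ∈ [0,1]` and every even integer `N ≥ 2`, the moment generating function
`M_τ` satisfies the seventh-order linear ODE `Σ_{k=0}^{7} A_k(t)·M_τ^{(k)}(t) = 0`. -/
theorem mgf_seventh_order_ODE (τ : ℝ) (hτ : τ ∈ Set.Icc (0:ℝ) 1)
    (N : ℕ) (hNeven : Even N) (hN2 : 2 ≤ N) (t : ℝ) :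
    ∑ k ∈ Finset.range 8, (Apoly τ (N : ℝ) k).eval t * iteratedDeriv k (MGF τ N) t = 0 := by
  obtain ⟨m, rfl⟩ := Nat.exists_eq_add_of_le' hN2
  have hpos : 0 < 1 + τ := by linarith [hτ.1]
  have hR1 := superExpDecay_R1 hpos m
  have hR2 := superExpDecay_R2 hpos m
  have hderiv (k : ℕ) : iteratedDeriv k (MGF τ (m + 2)) t
      = bilateralLaplace (fun x => x ^ k * R1 τ (m + 2) x) t
        + bilateralLaplace (fun x => x ^ k * R2 τ (m + 2) x) t := by
    rw [show MGF τ (m + 2) = bilateralLaplace fun x => R1 τ (m + 2) x + R2 τ (m + 2) x from rfl,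
      iteratedDeriv_bilateralLaplace (hR1.add hR2),
      ← bilateralLaplace_add (hR1.pow_mul k) (hR2.pow_mul k)]
    simp only [mul_add]
  simp only [hderiv]
  push_cast
  exact (laplaceSystem_density hpos m).sum_Apoly_eq_zero t
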